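/- Let v, w, z be pairwise distinct vertices such that EAT(z, w) > LDT(w, v), EAT(w, v) > LDT(v, z), and EAT(w, z) > LDT(z, v). Then no elementary partial route that visits all three of v, w, z and is feasible for some t ∈ [0, T] visits w strictly before v. -/

import Mathlib

noncomputable section

attribute [local instance] Classical.propDecidable

/-- `delta τ a r t i`: earliest arrival time at the `i`-th vertex of the partial route
`⟨r 0, …, r k⟩` when the vehicle departs from `r 0` at time `t`, taking waiting
times (lower time-window bounds `a`) into account. -/
def delta (τ : ℕ → ℕ → ℝ) (a : ℕ → ℝ) (r : ℕ → ℕ) (t : ℝ) : ℕ → ℝ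
  | 0 => max t (a (r 0))
  | i + 1 => max (delta τ a r t i + τ (r i) (r (i + 1))) (a (r (i + 1)))

/-- The partial route `⟨r 0, …, r k⟩` is feasible for departure time `t`:
the departure is not before `a (r 0)` and every vertex is reached before the
end `b` of its time window. -/
def Feasible (τ : ℕ → ℕ → ℝ) (a b : ℕ → ℝ) (r : ℕ → ℕ) (k : ℕ) (t : ℝ) : Prop :=
  a (r 0) ≤ t ∧ ∀ i ≤ k, delta τ a r t i ≤ b (r i)

/-- `EAT w v`: earliest arrival time at `v` after visiting `w`, i.e. the infimum of
the arrival times `delta τ a u (a w) k` over all partial routes `u` starting at `w`,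
ending at `v`, and feasible for departure time `a w` (`⊤ = ∞` if no such route exists). -/
def EAT (τ : ℕ → ℕ → ℝ) (a b : ℕ → ℝ) (w v : ℕ) : EReal :=
  sInf {x : EReal | ∃ (u : ℕ → ℕ) (k : ℕ), u 0 = w ∧ u k = v ∧
    Feasible τ a b u k (a w) ∧ x = ((delta τ a u (a w) k : ℝ) : EReal)}

/-- `LDT T w v`: latest departure time from `w` before visiting `v`, i.e. the supremum
of all times `t ∈ [0, T]` for which some partial route starting at `w` and ending at `v`
is feasible (`⊥ = -∞` if no such time exists). -/
def LDT (τ : ℕ → ℕ → ℝ) (a b : ℕ → ℝ) (T : ℝ) (w v : ℕ) : EReal :=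
  sSup {x : EReal | ∃ t : ℝ, x = (t : EReal) ∧ t ∈ Set.Icc 0 T ∧
    ∃ (u : ℕ → ℕ) (k : ℕ), u 0 = w ∧ u k = v ∧ Feasible τ a b u k t}

theorem le_delta (τ : ℕ → ℕ → ℝ) (a : ℕ → ℝ) (r : ℕ → ℕ) (t : ℝ) (i : ℕ) :
    a (r i) ≤ delta τ a r t i := by
  cases i <;> exact le_max_right _ _

theorem delta_mono (τ : ℕ → ℕ → ℝ) (a : ℕ → ℝ) (r : ℕ → ℕ) {s t : ℝ} (hst : s ≤ t) (i : ℕ) :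
    delta τ a r s i ≤ delta τ a r t i := by
  induction i with
  | zero => exact max_le_max_right _ hst
  | succ i ih => exact max_le_max_right _ (add_le_add_left ih _)

/-- Restarting a route at its `i`-th vertex at the arrival time there does not change the
later arrival times. -/
theorem delta_shift (τ : ℕ → ℕ → ℝ) (a : ℕ → ℝ) (r : ℕ → ℕ) (t : ℝ) (i m : ℕ) :
    delta τ a (fun n => r (i + n)) (delta τ a r t i) m = delta τ a r t (i + m) := by
  induction m with
  | zero => exact max_eq_left (le_delta τ a r t i)
  | succ m ih => rw [delta, ih]; rfl

theorem Feasible.shift {τ : ℕ → ℕ → ℝ} {a b : ℕ → ℝ} {r : ℕ → ℕ} {k : ℕ} {t : ℝ}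
    (h : Feasible τ a b r k t) {i m : ℕ} (him : i + m ≤ k) :
    Feasible τ a b (fun n => r (i + n)) m (delta τ a r t i) := by
  refine ⟨le_delta τ a r t i, fun n hn => ?_⟩
  rw [delta_shift]
  exact h.2 (i + n) (by omega)

theorem Feasible.anti {τ : ℕ → ℕ → ℝ} {a b : ℕ → ℝ} {r : ℕ → ℕ} {k : ℕ} {s t : ℝ}
    (h : Feasible τ a b r k t) (hs : a (r 0) ≤ s) (hst : s ≤ t) : Feasible τ a b r k s :=
  ⟨hs, fun i hi => (delta_mono τ a r hst i).trans (h.2 i hi)⟩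

theorem Feasible.EAT_le {τ : ℕ → ℕ → ℝ} {a b : ℕ → ℝ} {r : ℕ → ℕ} {k : ℕ} {t : ℝ}
    (h : Feasible τ a b r k t) {i j : ℕ} (hij : i ≤ j) (hj : j ≤ k) :
    EAT τ a b (r i) (r j) ≤ (delta τ a r t j : EReal) := by
  obtain ⟨m, rfl⟩ := Nat.exists_eq_add_of_le hij
  have hle := le_delta τ a r t i
  have hE : EAT τ a b (r i) (r (i + m)) ≤ (delta τ a (fun n => r (i + n)) (a (r i)) m : EReal) :=
    sInf_le ⟨fun n => r (i + n), m, rfl, rfl, (h.shift hj).anti le_rfl hle, rfl⟩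
  refine hE.trans ?_
  rw [← delta_shift]
  exact EReal.coe_le_coe (delta_mono τ a _ hle m)

theorem Feasible.le_LDT {τ : ℕ → ℕ → ℝ} {a b : ℕ → ℝ} {T : ℝ} (hwin : ∀ x, 0 ≤ a x ∧ b x ≤ T)
    {r : ℕ → ℕ} {k : ℕ} {t : ℝ} (h : Feasible τ a b r k t) {i j : ℕ} (hij : i ≤ j) (hj : j ≤ k) :
    (delta τ a r t i : EReal) ≤ LDT τ a b T (r i) (r j) := by
  obtain ⟨m, rfl⟩ := Nat.exists_eq_add_of_le hij
  exact le_sSup ⟨_, rfl,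
    ⟨(hwin _).1.trans (le_delta τ a r t i), (h.2 i (hij.trans hj)).trans (hwin _).2⟩,
    fun n => r (i + n), m, rfl, rfl, h.shift hj⟩

/-- A feasible route reaches its `j`-th vertex between the earliest arrival time after an
earlier vertex and the latest departure time before a later one. -/
theorem Feasible.EAT_le_LDT {τ : ℕ → ℕ → ℝ} {a b : ℕ → ℝ} {T : ℝ}
    (hwin : ∀ x, 0 ≤ a x ∧ b x ≤ T) {r : ℕ → ℕ} {k : ℕ} {t : ℝ} (h : Feasible τ a b r k t)
    {i j l : ℕ} (hij : i ≤ j) (hjl : j ≤ l) (hl : l ≤ k) :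
    EAT τ a b (r i) (r j) ≤ LDT τ a b T (r j) (r l) :=
  (h.EAT_le hij (hjl.trans hl)).trans (h.le_LDT hwin hjl hl)

/-- If `v, w, z` are pairwise distinct with `EAT z w > LDT w v`, `EAT w v > LDT v z`,
and `EAT w z > LDT z v`, then no elementary partial route that visits all three of
`v, w, z` and is feasible for some `t ∈ [0, T]` visits `w` strictly before `v`. -/
theorem stmt12 (τ : ℕ → ℕ → ℝ) (a b : ℕ → ℝ) (T : ℝ)
    (hab : ∀ x, a x ≤ b x) (hT : 0 ≤ T) (hwin : ∀ x, 0 ≤ a x ∧ b x ≤ T)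
    (v w z : ℕ) (hvw : v ≠ w) (hvz : v ≠ z) (hwz : w ≠ z)
    (h1 : LDT τ a b T w v < EAT τ a b z w)
    (h2 : LDT τ a b T v z < EAT τ a b w v)
    (h3 : LDT τ a b T z v < EAT τ a b w z) :
    ∀ (r : ℕ → ℕ) (k : ℕ) (t : ℝ),
      (∀ i ≤ k, ∀ j ≤ k, r i = r j → i = j) →
      t ∈ Set.Icc (0 : ℝ) T → Feasible τ a b r k t →
      (∃ iv ≤ k, r iv = v) → (∃ iw ≤ k, r iw = w) → (∃ iz ≤ k, r iz = z) →
      ¬ ∃ i j, i < j ∧ j ≤ k ∧ r i = w ∧ r j = v := by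
  rintro r k t - - hr - - ⟨iz, hzk, rfl⟩ ⟨i, j, hij, hjk, rfl, rfl⟩
  rcases le_total iz i with hzi | hiz
  · exact h1.not_ge (hr.EAT_le_LDT hwin hzi hij.le hjk)
  rcases le_total iz j with hzj | hjz
  · exact h3.not_ge (hr.EAT_le_LDT hwin hiz hzj hjk)
  · exact h2.not_ge (hr.EAT_le_LDT hwin hij.le hjz hzk)
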